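/- arXiv:2002.08456 — 8 statements merged into one kernel-verified Lean document; each statement's English description precedes it below -/
import Mathlib

section
/- Let (A^1, …, A^N, r^1, …, r^N) be an N-player finite normal-form game that is a zero-sum polymatrix game, i.e., there are pairwise payoffs r̃^{ij} : A^i × A^j → ℝ for i ≠ j with r^i(a) = Σ_{j≠i} r̃^{ij}(a_i, a_j) and r̃^{ij}(a_i, a_j) = −r̃^{ji}(a_j, a_i) for all actions. Then for all strategy profiles π and μ one has Σ_{i=1}^N Ω^i(π, μ) = 0; in particular such games are monotone. -/
open Finset

/-- A probability vector on a finite set: nonnegative entries summing to 1. -/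
def IsMixed {α : Type*} [Fintype α] (p : α → ℝ) : Prop :=
  (∀ a, 0 ≤ p a) ∧ ∑ a, p a = 1

/-- Expected payoff `V^i(π)` of player `i` in an N-player finite normal-form game. -/
noncomputable def Vfun {ι : Type*} [Fintype ι] [DecidableEq ι]
    {A : ι → Type*} [∀ i, Fintype (A i)]
    (r : (∀ j, A j) → ℝ) (π : ∀ j, A j → ℝ) : ℝ :=
  ∑ a : ∀ j, A j, (∏ j, π j (a j)) * r a

/-- `Ω^i(π, μ) = V^i(π) − V^i(μ^i, π^{-i}) − V^i(π^i, μ^{-i}) + V^i(μ)`. -/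
noncomputable def Omega {ι : Type*} [Fintype ι] [DecidableEq ι]
    {A : ι → Type*} [∀ i, Fintype (A i)]
    (r : ι → (∀ j, A j) → ℝ) (i : ι) (π μ : ∀ j, A j → ℝ) : ℝ :=
  Vfun (r i) π - Vfun (r i) (Function.update π i (μ i))
    - Vfun (r i) (Function.update μ i (π i)) + Vfun (r i) μ

/-- The expectation under a product of mixed strategies of a product of functions of two distinct
coordinates factors. -/
theorem sum_prod_mul_two_coordinates {ι : Type*} [Fintype ι] [DecidableEq ι]
    {A : ι → Type*} [∀ i, Fintype (A i)] {π : ∀ j, A j → ℝ} (hπ : ∀ k, IsMixed (π k))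
    {i j : ι} (hij : i ≠ j) (u : A i → ℝ) (v : A j → ℝ) :
    ∑ a : ∀ k, A k, (∏ k, π k (a k)) * (u (a i) * v (a j)) =
      (∑ x, π i x * u x) * ∑ y, π j y * v y := by
  let g : ∀ k, A k → ℝ := fun k z =>
    π k z * ((if h : k = i then u (h ▸ z) else 1) * (if h : k = j then v (h ▸ z) else 1))
  have hg : ∀ a : ∀ k, A k, (∏ k, π k (a k)) * (u (a i) * v (a j)) = ∏ k, g k (a k) := by
    intro a
    simp only [g, prod_mul_distrib]
    congr 2
    · rw [prod_eq_single i (by simp +contextual) (by simp)]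
      simp
    · rw [prod_eq_single j (by simp +contextual) (by simp)]
      simp
  simp only [hg]
  rw [← Fintype.prod_sum, prod_eq_mul i j hij]
  · simp [g, hij, hij.symm]
  · rintro k - ⟨hi, hj⟩
    simp [g, hi, hj, (hπ k).2]
  · simp
  · simp

/-- The expectation of a function of two distinct coordinates depends only on their marginals. -/
theorem Vfun_two_coordinates {ι : Type*} [Fintype ι] [DecidableEq ι]
    {A : ι → Type*} [∀ i, Fintype (A i)] {π : ∀ j, A j → ℝ} (hπ : ∀ k, IsMixed (π k))
    {i j : ι} (hij : i ≠ j) (f : A i → A j → ℝ) :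
    Vfun (fun a => f (a i) (a j)) π = ∑ x, ∑ y, π i x * π j y * f x y := by
  classical
  have hf : ∀ a : ∀ k, A k, f (a i) (a j) =
      ∑ x, (if a i = x then 1 else 0) * f x (a j) := by
    intro a
    simp
  simp only [Vfun]
  simp_rw [hf, mul_sum]
  rw [sum_comm]
  refine sum_congr rfl fun x _ => ?_
  rw [sum_prod_mul_two_coordinates hπ hij (fun z => if z = x then 1 else 0) (f x)]
  simp [mul_sum, mul_assoc]

theorem IsMixed.update {ι : Type*} [DecidableEq ι] {A : ι → Type*} [∀ i, Fintype (A i)]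
    {π : ∀ j, A j → ℝ} (hπ : ∀ k, IsMixed (π k)) {i : ι} {p : A i → ℝ} (hp : IsMixed p) (k : ι) :
    IsMixed (Function.update π i p k) := by
  rcases eq_or_ne k i with rfl | h
  · simpa using hp
  · simpa [h] using hπ k

theorem Vfun_sum {ι κ : Type*} [Fintype ι] [DecidableEq ι]
    {A : ι → Type*} [∀ i, Fintype (A i)] (s : Finset κ) (r : κ → (∀ j, A j) → ℝ)
    (π : ∀ j, A j → ℝ) : Vfun (fun a => ∑ k ∈ s, r k a) π = ∑ k ∈ s, Vfun (r k) π := by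
  simp only [Vfun, mul_sum]
  exact sum_comm

/-- In a polymatrix game, `Ω^i(π, μ)` is the sum of the pairwise payoffs of player `i`, extended
bilinearly and evaluated at `π - μ`. -/
theorem Omega_polymatrix {ι : Type*} [Fintype ι] [DecidableEq ι]
    {A : ι → Type*} [∀ i, Fintype (A i)]
    {r : ι → (∀ j, A j) → ℝ} {rt : ∀ i j : ι, A i → A j → ℝ}
    (hdecomp : ∀ i (a : ∀ j, A j), r i a = ∑ j ∈ univ.erase i, rt i j (a i) (a j))
    {π μ : ∀ j, A j → ℝ} (hπ : ∀ i, IsMixed (π i)) (hμ : ∀ i, IsMixed (μ i)) (i : ι) :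
    Omega r i π μ = ∑ j ∈ univ.erase i,
      ∑ x, ∑ y, (π i x - μ i x) * (π j y - μ j y) * rt i j x y := by
  rw [Omega, show r i = _ from funext (hdecomp i)]
  simp only [Vfun_sum, ← sum_sub_distrib, ← sum_add_distrib]
  refine sum_congr rfl fun j hj => ?_
  have hji : j ≠ i := ne_of_mem_erase hj
  rw [Vfun_two_coordinates hπ hji.symm, Vfun_two_coordinates hμ hji.symm,
    Vfun_two_coordinates (IsMixed.update hπ (hμ i)) hji.symm,
    Vfun_two_coordinates (IsMixed.update hμ (hπ i)) hji.symm]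
  simp only [Function.update_self, Function.update_of_ne hji, ← sum_sub_distrib,
    ← sum_add_distrib]
  refine sum_congr rfl fun x _ => sum_congr rfl fun y _ => ?_
  ring

/-- An antisymmetric family sums to zero over ordered pairs of distinct indices. -/
theorem sum_sum_erase_eq_zero_of_antisymm {ι : Type*} [Fintype ι] [DecidableEq ι]
    (w : ι → ι → ℝ) (hw : ∀ i j, i ≠ j → w i j = -w j i) :
    ∑ i, ∑ j ∈ univ.erase i, w i j = 0 := by
  have hswap : ∑ i, ∑ j ∈ univ.erase i, w i j = ∑ j, ∑ i ∈ univ.erase j, w i j :=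
    sum_comm' (by simp [ne_comm])
  have hneg : ∑ j, ∑ i ∈ univ.erase j, w i j = -∑ j, ∑ i ∈ univ.erase j, w j i := by
    simp only [← sum_neg_distrib]
    exact sum_congr rfl fun j _ => sum_congr rfl fun i hi => hw i j (ne_of_mem_erase hi)
  linarith

/-- In a zero-sum polymatrix game, `Σ_i Ω^i(π, μ) = 0` for all strategy profiles;
in particular such games are monotone. -/
theorem zero_sum_polymatrix_monotone
    {ι : Type*} [Fintype ι] [DecidableEq ι]
    {A : ι → Type*} [∀ i, Fintype (A i)] [∀ i, Nonempty (A i)]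
    (r : ι → (∀ j, A j) → ℝ) (rt : ∀ i j : ι, A i → A j → ℝ)
    (hdecomp : ∀ i (a : ∀ j, A j), r i a = ∑ j ∈ univ.erase i, rt i j (a i) (a j))
    (hanti : ∀ i j : ι, i ≠ j → ∀ (x : A i) (y : A j), rt i j x y = - rt j i y x)
    (π μ : ∀ j, A j → ℝ) (hπ : ∀ i, IsMixed (π i)) (hμ : ∀ i, IsMixed (μ i)) :
    (∑ i, Omega r i π μ = 0) ∧ (∑ i, Omega r i π μ ≤ 0) := by
  have h : ∑ i, Omega r i π μ = 0 := by
    simp only [Omega_polymatrix hdecomp hπ hμ]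
    refine sum_sum_erase_eq_zero_of_antisymm
      (fun i j => ∑ x, ∑ y, (π i x - μ i x) * (π j y - μ j y) * rt i j x y) fun i j hij => ?_
    rw [sum_comm]
    simp only [← sum_neg_distrib]
    refine sum_congr rfl fun y _ => sum_congr rfl fun x _ => ?_
    rw [hanti i j hij]
    ring
  exact ⟨h, h.le⟩
end

section
/- Consider a two-player finite normal-form game with policy-dependent payoffs r^i_π that is zero-sum at every profile (r^2_π = −r^1_π for every strategy profile π). Let π* be any strategy profile (in the paper, a Nash equilibrium), and let t ↦ y_t = (y_t^1, y_t^2) be differentiable FoReL dynamics: π_t^i = softmax(y_t^i) and d/dt y_t^i(a) = Q^i_{π_t}(a) for every a ∈ A^i. Then for every t, d/dt J_{π*}(y_t) = Σ_{i=1}^2 [V^i(π_t^i, π*^{-i}) − V^i(π*)] + Σ_{i=1}^2 Σ_{a^i ∈ A^i} Σ_{a^{-i} ∈ A^{-i}} π*^i(a^i) π_t^{-i}(a^{-i}) [ r^i_{(π*^i, π_t^{-i})}(a^i, a^{-i}) − r^i_{π_t}(a^i, a^{-i}) ]. -/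
open Finset

/-- `softmax(y)(a) = exp(y(a)) / Σ_b exp(y(b))`. -/
noncomputable def softmax {α : Type*} [Fintype α] (y : α → ℝ) (a : α) : ℝ :=
  Real.exp (y a) / ∑ b, Real.exp (y b)

/-- Expected payoff `V^i(π) = Σ_{a,b} π¹(a) π²(b) r^i_π(a,b)` for a policy-dependent
payoff `r^i` in a two-player game. -/
noncomputable def val2d {A B : Type*} [Fintype A] [Fintype B]
    (r : (A → ℝ) → (B → ℝ) → A → B → ℝ) (p : A → ℝ) (q : B → ℝ) : ℝ :=
  ∑ a, ∑ b, p a * q b * r p q a b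

theorem isMixed_softmax {α : Type*} [Fintype α] [Nonempty α] (y : α → ℝ) :
    IsMixed (softmax y) := by
  have hpos : 0 < ∑ b, Real.exp (y b) :=
    Finset.sum_pos (fun b _ => Real.exp_pos _) Finset.univ_nonempty
  refine ⟨fun a => div_nonneg (Real.exp_pos _).le hpos.le, ?_⟩
  simp only [softmax]
  rw [← Finset.sum_div, div_self hpos.ne']

theorem hasDerivAt_log_sum_exp_sub_sum_mul {α : Type*} [Fintype α] [Nonempty α]
    {y : ℝ → α → ℝ} {y' : α → ℝ} {t : ℝ} (s : α → ℝ)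
    (hy : ∀ a, HasDerivAt (fun u => y u a) (y' a) t) :
    HasDerivAt (fun u => Real.log (∑ a, Real.exp (y u a)) - ∑ a, s a * y u a)
      (∑ a, softmax (y t) a * y' a - ∑ a, s a * y' a) t := by
  have hpos : 0 < ∑ b, Real.exp (y t b) :=
    Finset.sum_pos (fun b _ => Real.exp_pos _) Finset.univ_nonempty
  have hexp : HasDerivAt (fun u => ∑ a, Real.exp (y u a))
      (∑ a, Real.exp (y t a) * y' a) t :=
    HasDerivAt.fun_sum fun a _ => (hy a).exp
  have hlin : HasDerivAt (fun u => ∑ a, s a * y u a) (∑ a, s a * y' a) t :=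
    HasDerivAt.fun_sum fun a _ => (hy a).const_mul (s a)
  refine ((hexp.log hpos.ne').sub hlin).congr_deriv ?_
  simp only [softmax, Finset.sum_div, div_mul_eq_mul_div]

/-- Zero-sum payoffs give opposite values, with the second player's sum taken in the
other order. -/
theorem val2d_add_sum_comm_eq_zero {A B : Type*} [Fintype A] [Fintype B]
    {r1 r2 : (A → ℝ) → (B → ℝ) → A → B → ℝ} {p : A → ℝ} {q : B → ℝ}
    (h : ∀ a b, r2 p q a b = - r1 p q a b) :
    val2d r1 p q + ∑ b, ∑ a, q b * p a * r2 p q a b = 0 := by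
  rw [val2d, Finset.sum_comm, ← Finset.sum_add_distrib]
  refine Finset.sum_eq_zero fun b _ => ?_
  rw [← Finset.sum_add_distrib]
  refine Finset.sum_eq_zero fun a _ => ?_
  rw [h]
  ring

theorem val2d_add_val2d_eq_zero {A B : Type*} [Fintype A] [Fintype B]
    {r1 r2 : (A → ℝ) → (B → ℝ) → A → B → ℝ} {p : A → ℝ} {q : B → ℝ}
    (h : ∀ a b, r2 p q a b = - r1 p q a b) :
    val2d r1 p q + val2d r2 p q = 0 := by
  simp [val2d, h]

/-- Lemma 1 (two-player, zero-sum at every profile): the derivative of the FoReL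
Lyapunov candidate `J_{π*}` along entropy-FoReL dynamics equals the Nash gap term plus
the policy-dependent reward-difference term. -/
theorem deriv_J_forel_policy_dependent
    {A B : Type*} [Fintype A] [Fintype B] [Nonempty A] [Nonempty B]
    (r1 r2 : (A → ℝ) → (B → ℝ) → A → B → ℝ)
    (hzs : ∀ (p : A → ℝ) (q : B → ℝ), IsMixed p → IsMixed q →
      ∀ a b, r2 p q a b = - r1 p q a b)
    (s1 : A → ℝ) (s2 : B → ℝ) (hs1 : IsMixed s1) (hs2 : IsMixed s2)
    (y1 : ℝ → A → ℝ) (y2 : ℝ → B → ℝ)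
    (hy1 : ∀ t a, HasDerivAt (fun s => y1 s a)
      (∑ b, softmax (y2 t) b * r1 (softmax (y1 t)) (softmax (y2 t)) a b) t)
    (hy2 : ∀ t b, HasDerivAt (fun s => y2 s b)
      (∑ a, softmax (y1 t) a * r2 (softmax (y1 t)) (softmax (y2 t)) a b) t) :
    ∀ t, HasDerivAt (fun s =>
        (Real.log (∑ a, Real.exp (y1 s a)) - ∑ a, s1 a * y1 s a) +
        (Real.log (∑ b, Real.exp (y2 s b)) - ∑ b, s2 b * y2 s b))
      (((val2d r1 (softmax (y1 t)) s2 - val2d r1 s1 s2) +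
        (val2d r2 s1 (softmax (y2 t)) - val2d r2 s1 s2)) +
       ((∑ a, ∑ b, s1 a * softmax (y2 t) b *
          (r1 s1 (softmax (y2 t)) a b - r1 (softmax (y1 t)) (softmax (y2 t)) a b)) +
        (∑ b, ∑ a, s2 b * softmax (y1 t) a *
          (r2 (softmax (y1 t)) s2 a b - r2 (softmax (y1 t)) (softmax (y2 t)) a b)))) t := by
  intro t
  have hp := isMixed_softmax (y1 t)
  have hq := isMixed_softmax (y2 t)
  refine ((hasDerivAt_log_sum_exp_sub_sum_mul s1 (hy1 t)).add
    (hasDerivAt_log_sum_exp_sub_sum_mul s2 (hy2 t))).congr_deriv ?_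
  have hpq := val2d_add_sum_comm_eq_zero (hzs _ _ hp hq)
  have hps := val2d_add_sum_comm_eq_zero (hzs _ _ hp hs2)
  have hsq := val2d_add_val2d_eq_zero (hzs _ _ hs1 hq)
  have hss := val2d_add_val2d_eq_zero (hzs _ _ hs1 hs2)
  have hpq1 : val2d r1 (softmax (y1 t)) (softmax (y2 t)) = ∑ a, ∑ b,
      softmax (y1 t) a * softmax (y2 t) b * r1 (softmax (y1 t)) (softmax (y2 t)) a b := rfl
  have hsq1 : val2d r1 s1 (softmax (y2 t)) = ∑ a, ∑ b,
      s1 a * softmax (y2 t) b * r1 s1 (softmax (y2 t)) a b := rfl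
  simp only [Finset.mul_sum, ← mul_assoc, mul_sub, Finset.sum_sub_distrib]
  linarith
end

section
/- Let (A^1, …, A^N, r^1, …, r^N) be a monotone N-player finite normal-form game, η > 0, and μ̄ an interior strategy profile. Define the transformed values Ṽ^i(π) = V^i(π) − η·KL(π^i, μ̄^i), and let π* be an interior Nash equilibrium of the transformed game. Let t ↦ y_t be differentiable FoReL dynamics: π_t^i = softmax(y_t^i) and d/dt y_t^i(a) = Q^i_{π_t}(a) − η log(π_t^i(a)/μ̄^i(a)), where Q^i is the Q-function of the original game. Then Ξ(t) = Σ_{i=1}^N KL(π*^i, π_t^i) satisfies Ξ(t) ≤ Ξ(0) · exp(−η t) for all t ≥ 0, i.e., the FoReL policies converge exponentially fast to π*. -/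
open Finset

/-- A strictly positive (interior) vector. -/
def IsInterior {α : Type*} [Fintype α] (p : α → ℝ) : Prop :=
  ∀ a, 0 < p a

/-- Kullback–Leibler divergence `KL(p, q) = Σ_a p(a) log(p(a)/q(a))`. -/
noncomputable def KL {α : Type*} [Fintype α] (p q : α → ℝ) : ℝ :=
  ∑ a, p a * Real.log (p a / q a)

/-- `Q^i_π(a)`: the expected payoff to player `i` of playing action `a` against `π^{-i}`. -/
noncomputable def Qfun {ι : Type*} [Fintype ι] [DecidableEq ι]
    {A : ι → Type*} [∀ i, Fintype (A i)] [∀ i, DecidableEq (A i)]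
    (r : (∀ j, A j) → ℝ) (π : ∀ j, A j → ℝ) (i : ι) (a : A i) : ℝ :=
  Vfun r (Function.update π i (fun a' => if a' = a then (1 : ℝ) else 0))

theorem prod_update_apply {ι : Type*} [Fintype ι] [DecidableEq ι] {A : ι → Type*}
    (π : ∀ j, A j → ℝ) (i : ι) (p : A i → ℝ) (b : ∀ j, A j) :
    ∏ j, Function.update π i p j (b j) = p (b i) * ∏ j ∈ univ.erase i, π j (b j) := by
  rw [← Finset.mul_prod_erase univ _ (mem_univ i), Function.update_self]
  congr 1
  refine Finset.prod_congr rfl fun j hj => ?_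
  rw [Function.update_of_ne (Finset.ne_of_mem_erase hj)]

/-- The payoff is linear in the strategy of one player, with the Q-function as coefficients. -/
theorem Vfun_update_eq_sum_Qfun {ι : Type*} [Fintype ι] [DecidableEq ι]
    {A : ι → Type*} [∀ i, Fintype (A i)] [∀ i, DecidableEq (A i)]
    (r : (∀ j, A j) → ℝ) (π : ∀ j, A j → ℝ) (i : ι) (p : A i → ℝ) :
    Vfun r (Function.update π i p) = ∑ a, p a * Qfun r π i a := by
  simp only [Qfun, Vfun, prod_update_apply, Finset.mul_sum]
  rw [Finset.sum_comm]
  refine Finset.sum_congr rfl fun b _ => ?_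
  rw [Finset.sum_eq_single (b i)]
  · simp [mul_assoc]
  · intro a _ ha
    simp [ha.symm]
  · simp

theorem sum_exp_pos {α : Type*} [Fintype α] [Nonempty α] (y : α → ℝ) :
    0 < ∑ b, Real.exp (y b) :=
  Finset.sum_pos (fun _ _ => Real.exp_pos _) univ_nonempty

theorem isInterior_softmax {α : Type*} [Fintype α] [Nonempty α] (y : α → ℝ) :
    IsInterior (softmax y) :=
  fun a => div_pos (Real.exp_pos (y a)) (sum_exp_pos y)

theorem KL_softmax {α : Type*} [Fintype α] [Nonempty α] {p : α → ℝ} (hp : IsMixed p)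
    (hpI : IsInterior p) (y : α → ℝ) :
    KL p (softmax y) =
      ∑ a, p a * Real.log (p a) - ∑ a, p a * y a + Real.log (∑ b, Real.exp (y b)) := by
  have h : ∀ a, p a * Real.log (p a / softmax y a) =
      p a * Real.log (p a) - p a * y a + p a * Real.log (∑ b, Real.exp (y b)) := by
    intro a
    rw [Real.log_div (hpI a).ne' (isInterior_softmax y a).ne', softmax,
      Real.log_div (Real.exp_pos _).ne' (sum_exp_pos y).ne', Real.log_exp]
    ring
  simp only [KL, h, Finset.sum_add_distrib, Finset.sum_sub_distrib, ← Finset.sum_mul, hp.2,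
    one_mul]

theorem hasDerivAt_KL_softmax {α : Type*} [Fintype α] [Nonempty α] {p : α → ℝ}
    (hp : IsMixed p) (hpI : IsInterior p) {y : ℝ → α → ℝ} {y' : α → ℝ} {t : ℝ}
    (hy : ∀ a, HasDerivAt (fun s => y s a) (y' a) t) :
    HasDerivAt (fun s => KL p (softmax (y s)))
      (∑ a, softmax (y t) a * y' a - ∑ a, p a * y' a) t := by
  simp only [KL_softmax hp hpI]
  have h₁ : HasDerivAt (fun s => ∑ a, p a * y s a) (∑ a, p a * y' a) t :=
    HasDerivAt.fun_sum fun a _ => (hy a).const_mul (p a)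
  have h₂ : HasDerivAt (fun s => ∑ a, Real.exp (y s a)) (∑ a, Real.exp (y t a) * y' a) t :=
    HasDerivAt.fun_sum fun a _ => (hy a).exp
  have h₃ : (∑ a, Real.exp (y t a) * y' a) / ∑ b, Real.exp (y t b) =
      ∑ a, softmax (y t) a * y' a := by
    rw [Finset.sum_div]
    exact Finset.sum_congr rfl fun a _ => mul_div_right_comm _ _ _
  have h := (h₁.const_sub (∑ a, p a * Real.log (p a))).add (h₂.log (sum_exp_pos (y t)).ne')
  rw [h₃] at h
  exact h.congr_deriv (by ring)

/-- The three-point identity for the Kullback–Leibler divergence. -/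
theorem sum_mul_log_div_eq_KL_sub_KL {α : Type*} [Fintype α] {p q m : α → ℝ}
    (hp : IsInterior p) (hq : IsInterior q) (hm : IsInterior m) :
    ∑ a, p a * Real.log (q a / m a) = KL p m - KL p q := by
  rw [KL, KL, ← Finset.sum_sub_distrib]
  refine Finset.sum_congr rfl fun a _ => ?_
  rw [Real.log_div (hq a).ne' (hm a).ne', Real.log_div (hp a).ne' (hm a).ne',
    Real.log_div (hp a).ne' (hq a).ne']
  ring

/-- A form of Grönwall's inequality: `f' ≤ -η f` forces exponential decay. -/
theorem le_mul_exp_of_hasDerivAt_le {f f' : ℝ → ℝ} {η : ℝ}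
    (hf : ∀ t, HasDerivAt f (f' t) t) (hf' : ∀ t, f' t ≤ -η * f t) {t : ℝ} (ht : 0 ≤ t) :
    f t ≤ f 0 * Real.exp (-η * t) := by
  have hg : ∀ s, HasDerivAt (fun s => f s * Real.exp (η * s))
      ((f' s + η * f s) * Real.exp (η * s)) s := fun s =>
    ((hf s).mul ((hasDerivAt_id s).const_mul η).exp).congr_deriv (by simp; ring)
  have hanti : Antitone fun s => f s * Real.exp (η * s) := by
    refine antitone_of_deriv_nonpos (fun s => (hg s).differentiableAt) fun s => ?_
    rw [(hg s).deriv]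
    exact mul_nonpos_of_nonpos_of_nonneg (by linarith [hf' s]) (Real.exp_pos _).le
  have h := mul_le_mul_of_nonneg_right (hanti ht) (Real.exp_pos (-η * t)).le
  simpa [mul_assoc, ← Real.exp_add] using h

/-- In a monotone game with the transformed values `Ṽ^i(π) = V^i(π) − η·KL(π^i, μ̄^i)`,
the sum of KL divergences `Ξ(t) = Σ_i KL(π*^i, π_t^i)` between an interior Nash
equilibrium `π*` of the transformed game and the FoReL policies decays exponentially:
`Ξ(t) ≤ Ξ(0)·exp(−η t)`. -/
theorem KL_exponential_decay_monotone_transform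
    {ι : Type*} [Fintype ι] [DecidableEq ι]
    {A : ι → Type*} [∀ i, Fintype (A i)] [∀ i, DecidableEq (A i)] [∀ i, Nonempty (A i)]
    (r : ι → (∀ j, A j) → ℝ)
    (hmono : ∀ π μ : ∀ j, A j → ℝ, (∀ i, IsMixed (π i)) → (∀ i, IsMixed (μ i)) →
      ∑ i, Omega r i π μ ≤ 0)
    (η : ℝ) (hη : 0 < η)
    (m : ∀ i, A i → ℝ) (hm : ∀ i, IsMixed (m i)) (hmI : ∀ i, IsInterior (m i))
    (st : ∀ j, A j → ℝ) (hst : ∀ i, IsMixed (st i)) (hstI : ∀ i, IsInterior (st i))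
    (hN : ∀ i (p : A i → ℝ), IsMixed p →
      Vfun (r i) (Function.update st i p) - η * KL p (m i) ≤
        Vfun (r i) st - η * KL (st i) (m i))
    (y : ℝ → ∀ i, A i → ℝ)
    (hy : ∀ t i a, HasDerivAt (fun s => y s i a)
      (Qfun (r i) (fun j => softmax (y t j)) i a
        - η * Real.log (softmax (y t i) a / m i a)) t) :
    ∀ t ≥ (0 : ℝ),
      ∑ i, KL (st i) (softmax (y t i)) ≤
        (∑ i, KL (st i) (softmax (y 0 i))) * Real.exp (- η * t) := by
  intro t ht
  refine le_mul_exp_of_hasDerivAt_le (f := fun s => ∑ i, KL (st i) (softmax (y s i)))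
    (fun s => HasDerivAt.fun_sum fun i _ =>
      hasDerivAt_KL_softmax (hst i) (hstI i) (hy s i)) (fun s => ?_) ht
  set π : ∀ j, A j → ℝ := fun j => softmax (y s j) with hπ
  have hlin : ∀ i (p : A i → ℝ), IsInterior p →
      ∑ a, p a * (Qfun (r i) π i a - η * Real.log (π i a / m i a)) =
        Vfun (r i) (Function.update π i p) - η * (KL p (m i) - KL p (π i)) := by
    intro i p hp
    rw [Vfun_update_eq_sum_Qfun,
      ← sum_mul_log_div_eq_KL_sub_KL hp (isInterior_softmax (y s i)) (hmI i),
      Finset.mul_sum, ← Finset.sum_sub_distrib]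
    exact Finset.sum_congr rfl fun a _ => by ring
  have hself : ∀ i, KL (π i) (π i) = 0 := fun i => by
    simp [KL, (isInterior_softmax (y s i) _).ne', hπ]
  have hterm : ∀ i,
      ∑ a, π i a * (Qfun (r i) π i a - η * Real.log (π i a / m i a)) -
        ∑ a, st i a * (Qfun (r i) π i a - η * Real.log (π i a / m i a)) ≤
      Omega r i π st - η * KL (st i) (π i) := by
    intro i
    rw [hlin i _ (isInterior_softmax (y s i)), hlin i _ (hstI i), hself,
      Function.update_eq_self, Omega]
    linarith [hN i (π i) (isMixed_softmax (y s i))]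
  refine (Finset.sum_le_sum fun i _ => hterm i).trans ?_
  rw [Finset.sum_sub_distrib, ← Finset.mul_sum]
  linarith [hmono π st (fun i => isMixed_softmax (y s i)) hst]
end

section
/- Let (A^1, …, A^N, r^1, …, r^N) be an N-player finite normal-form game with policy-independent payoffs, and fix a base action a^i_0 ∈ A^i for each player. On the Euclidean space W = Π_i ℝ^{A^i}, define the FoReL vector field ξ(w)^i(a) = Q^i_{σ(w)}(a) − Q^i_{σ(w)}(a^i_0), where σ(w) = (softmax(w^1), …, softmax(w^N)). Then ξ is continuously differentiable and divergence-free: Σ_{i=1}^N Σ_{a ∈ A^i} ∂ξ(w)^i(a)/∂w^i(a) = 0 for every w ∈ W. -/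
open Finset

/-- The shifted FoReL vector field
`ξ(w)^i(a) = Q^i_{σ(w)}(a) − Q^i_{σ(w)}(a^i_0)` with `σ(w) = softmax(w)` componentwise. -/
noncomputable def xiF {ι : Type*} [Fintype ι] [DecidableEq ι]
    {A : ι → Type*} [∀ i, Fintype (A i)] [∀ i, DecidableEq (A i)]
    (r : ι → (∀ j, A j) → ℝ) (a0 : ∀ i, A i) (w : ∀ i, A i → ℝ) : ∀ i, A i → ℝ :=
  fun i a => Qfun (r i) (fun j => softmax (w j)) i a
    - Qfun (r i) (fun j => softmax (w j)) i (a0 i)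

/-- The softmax map is smooth in the logits. -/
theorem contDiff_softmax {α : Type*} [Fintype α] [Nonempty α] {n : WithTop ℕ∞} (a : α) :
    ContDiff ℝ n (fun y : α → ℝ => softmax y a) := by
  unfold softmax
  refine ContDiff.div (by fun_prop) (by fun_prop) fun y => ?_
  exact ne_of_gt (Finset.sum_pos (fun b _ => Real.exp_pos (y b)) univ_nonempty)

/-- `Q^i` at the softmax profile is smooth in the logits. -/
theorem contDiff_Qfun_softmax {ι : Type*} [Fintype ι] [DecidableEq ι]
    {A : ι → Type*} [∀ i, Fintype (A i)] [∀ i, DecidableEq (A i)] [∀ i, Nonempty (A i)]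
    {n : WithTop ℕ∞} (r : (∀ j, A j) → ℝ) (i : ι) (a : A i) :
    ContDiff ℝ n (fun w : ∀ j, A j → ℝ => Qfun r (fun j => softmax (w j)) i a) := by
  unfold Qfun Vfun
  refine ContDiff.sum fun b _ => ContDiff.mul (contDiff_prod fun j _ => ?_) contDiff_const
  by_cases h : j = i
  · subst h
    simp only [Function.update_self]
    exact contDiff_const
  · simp only [Function.update_of_ne h]
    exact (contDiff_softmax (b j)).comp (contDiff_pi.1 contDiff_id j)

/-- `Q^i` does not depend on the strategy of player `i`. -/
theorem Qfun_congr {ι : Type*} [Fintype ι] [DecidableEq ι]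
    {A : ι → Type*} [∀ i, Fintype (A i)] [∀ i, DecidableEq (A i)]
    (r : (∀ j, A j) → ℝ) {π ρ : ∀ j, A j → ℝ} {i : ι} (h : ∀ j, j ≠ i → π j = ρ j) (a : A i) :
    Qfun r π i a = Qfun r ρ i a := by
  unfold Qfun
  congr 1
  ext j : 1
  by_cases hj : j = i
  · subst hj
    simp
  · simp [Function.update_of_ne hj, h j hj]

/-- The FoReL vector field is continuously differentiable and divergence-free:
`Σ_i Σ_{a ∈ A^i} ∂ξ(w)^i(a)/∂w^i(a) = 0` for every `w`. -/
theorem forel_field_divergence_free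
    {ι : Type*} [Fintype ι] [DecidableEq ι]
    {A : ι → Type*} [∀ i, Fintype (A i)] [∀ i, DecidableEq (A i)] [∀ i, Nonempty (A i)]
    (r : ι → (∀ j, A j) → ℝ) (a0 : ∀ i, A i) :
    ContDiff ℝ 1 (xiF r a0) ∧
    ∀ w : ∀ i, A i → ℝ,
      ∑ i, ∑ a : A i,
        deriv (fun s : ℝ => xiF r a0 (w + s • (Pi.single i (Pi.single a (1 : ℝ)) : ∀ j, A j → ℝ)) i a) 0
      = 0 := by
  constructor
  · refine contDiff_pi.2 fun i => contDiff_pi.2 fun a => ?_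
    exact (contDiff_Qfun_softmax (r i) i a).sub (contDiff_Qfun_softmax (r i) i (a0 i))
  · intro w
    refine Finset.sum_eq_zero fun i _ => Finset.sum_eq_zero fun a _ => ?_
    have key : ∀ s : ℝ,
        xiF r a0 (w + s • (Pi.single i (Pi.single a (1 : ℝ)) : ∀ j, A j → ℝ)) i a
          = xiF r a0 w i a := by
      intro s
      have h : ∀ j, j ≠ i →
          softmax ((w + s • (Pi.single i (Pi.single a (1 : ℝ)) : ∀ j, A j → ℝ)) j)
            = softmax (w j) := by
        intro j hj
        simp [Pi.single_eq_of_ne hj]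
      unfold xiF
      rw [Qfun_congr (r i) h, Qfun_congr (r i) h]
    simp only [key, deriv_const]
end

section
/- Let (A^1, A^2, r^1, r^2) be a zero-sum two-player finite normal-form game (r^2 = −r^1) with policy-independent payoffs admitting an interior Nash equilibrium π*. Let t ↦ y_t be differentiable FoReL dynamics: π_t^i = softmax(y_t^i) and d/dt y_t^i(a) = Q^i_{π_t}(a) for all a ∈ A^i. Then t ↦ J_{π*}(y_t) is nonincreasing: J_{π*}(y_t) ≤ J_{π*}(y_0) for all t ≥ 0. -/
open Finset

/-- Expected payoff in a two-player finite normal-form game. -/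
noncomputable def val2 {A B : Type*} [Fintype A] [Fintype B]
    (r : A → B → ℝ) (p : A → ℝ) (q : B → ℝ) : ℝ :=
  ∑ a, ∑ b, p a * q b * r a b

/-- The gradient of log-sum-exp is softmax; hence the derivative of the gap
`log Σ exp y - ⟨s, y⟩` along a path with velocity `v` is `⟨softmax y - s, v⟩`. -/
theorem hasDerivAt_logSumExp_sub_inner {α : Type*} [Fintype α] [Nonempty α]
    (s : α → ℝ) (y : ℝ → α → ℝ) (v : α → ℝ) (t : ℝ)
    (hy : ∀ a, HasDerivAt (fun u => y u a) (v a) t) :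
    HasDerivAt (fun u => Real.log (∑ a, Real.exp (y u a)) - ∑ a, s a * y u a)
      (∑ a, softmax (y t) a * v a - ∑ a, s a * v a) t := by
  have hpos : 0 < ∑ b, Real.exp (y t b) :=
    Finset.sum_pos (fun b _ => Real.exp_pos _) Finset.univ_nonempty
  have hexp : HasDerivAt (fun u => ∑ a, Real.exp (y u a))
      (∑ a, Real.exp (y t a) * v a) t :=
    HasDerivAt.fun_sum fun a _ => (hy a).exp
  have hlin : HasDerivAt (fun u => ∑ a, s a * y u a) (∑ a, s a * v a) t :=
    HasDerivAt.fun_sum fun a _ => (hy a).const_mul (s a)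
  have hgrad : ∑ a, softmax (y t) a * v a =
      (∑ a, Real.exp (y t a) * v a) / ∑ b, Real.exp (y t b) := by
    rw [Finset.sum_div]
    exact Finset.sum_congr rfl fun a _ => by simp only [softmax]; ring
  rw [hgrad]
  exact (hexp.log hpos.ne').sub hlin

theorem val2_eq_sum_left {A B : Type*} [Fintype A] [Fintype B]
    (r : A → B → ℝ) (p : A → ℝ) (q : B → ℝ) :
    ∑ a, p a * ∑ b, q b * r a b = val2 r p q := by
  simp only [val2, Finset.mul_sum, mul_assoc]

theorem val2_neg_eq_sum_right {A B : Type*} [Fintype A] [Fintype B]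
    (r : A → B → ℝ) (p : A → ℝ) (q : B → ℝ) :
    ∑ b, q b * ∑ a, p a * (- r a b) = - val2 r p q := by
  simp only [val2, Finset.mul_sum]
  rw [Finset.sum_comm]
  simp only [← Finset.sum_neg_distrib]
  exact Finset.sum_congr rfl fun a _ => Finset.sum_congr rfl fun b _ => by ring

theorem val2_neg {A B : Type*} [Fintype A] [Fintype B]
    (r : A → B → ℝ) (p : A → ℝ) (q : B → ℝ) :
    val2 (fun a b => - r a b) p q = - val2 r p q := by
  simp only [val2, mul_neg, Finset.sum_neg_distrib]

/-- In a zero-sum two-player game with an interior Nash equilibrium `π* = (s1, s2)`,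
the quantity `J_{π*}(y_t)` is nonincreasing along FoReL dynamics. -/
theorem J_nonincreasing_zero_sum_forel
    {A B : Type*} [Fintype A] [Fintype B] [Nonempty A] [Nonempty B]
    (r : A → B → ℝ)
    (s1 : A → ℝ) (s2 : B → ℝ)
    (hs1 : IsMixed s1) (hs1I : IsInterior s1) (hs2 : IsMixed s2) (hs2I : IsInterior s2)
    (hN1 : ∀ p : A → ℝ, IsMixed p → val2 r p s2 ≤ val2 r s1 s2)
    (hN2 : ∀ q : B → ℝ, IsMixed q →
      val2 (fun a b => - r a b) s1 q ≤ val2 (fun a b => - r a b) s1 s2)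
    (y1 : ℝ → A → ℝ) (y2 : ℝ → B → ℝ)
    (hy1 : ∀ t a, HasDerivAt (fun s => y1 s a) (∑ b, softmax (y2 t) b * r a b) t)
    (hy2 : ∀ t b, HasDerivAt (fun s => y2 s b) (∑ a, softmax (y1 t) a * (- r a b)) t) :
    ∀ t ≥ (0 : ℝ),
      (Real.log (∑ a, Real.exp (y1 t a)) - ∑ a, s1 a * y1 t a) +
        (Real.log (∑ b, Real.exp (y2 t b)) - ∑ b, s2 b * y2 t b) ≤
      (Real.log (∑ a, Real.exp (y1 0 a)) - ∑ a, s1 a * y1 0 a) +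
        (Real.log (∑ b, Real.exp (y2 0 b)) - ∑ b, s2 b * y2 0 b) := by
  intro t ht
  have hderiv (u : ℝ) :=
    (hasDerivAt_logSumExp_sub_inner s1 y1 _ u (hy1 u)).add
      (hasDerivAt_logSumExp_sub_inner s2 y2 _ u (hy2 u))
  refine antitone_of_hasDerivAt_nonpos hderiv (fun u => ?_) ht
  have h1 := hN1 _ (isMixed_softmax (y1 u))
  have h2 := hN2 _ (isMixed_softmax (y2 u))
  rw [val2_neg, val2_neg] at h2
  simp only [val2_neg_eq_sum_right]
  simp only [val2_eq_sum_left, Pi.zero_apply]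
  linarith
end

section
/- Let (A^1, …, A^N, r^1, …, r^N) be a monotone N-player finite normal-form game, η > 0, and μ̄ an interior strategy profile, and consider the transformed game with values Ṽ^i(π) = V^i(π) − η·KL(π^i, μ̄^i). Then the transformed game has at most one Nash equilibrium: any two Nash equilibria of the transformed game are equal. -/
open Finset

/-- The payoff of player `i` is affine in any one player's strategy. -/
lemma Vfun_update_midpoint {ι : Type*} [Fintype ι] [DecidableEq ι]
    {A : ι → Type*} [∀ i, Fintype (A i)]
    (r : (∀ j, A j) → ℝ) (π : ∀ j, A j → ℝ) (i : ι) (p q : A i → ℝ) :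
    Vfun r (Function.update π i fun a => (p a + q a) / 2) =
      (Vfun r (Function.update π i p) + Vfun r (Function.update π i q)) / 2 := by
  have key (s : A i → ℝ) (a : ∀ j, A j) :
      ∏ j, Function.update π i s j (a j) = s (a i) * ∏ j ∈ univ.erase i, π j (a j) := by
    rw [← mul_prod_erase univ _ (mem_univ i), Function.update_self]
    congr 1
    refine prod_congr rfl fun j hj => ?_
    rw [Function.update_of_ne (ne_of_mem_erase hj)]
  simp only [Vfun, key]
  rw [← sum_add_distrib, sum_div]
  refine sum_congr rfl fun a _ => ?_
  ring

lemma IsMixed.midpoint {α : Type*} [Fintype α] {p q : α → ℝ} (hp : IsMixed p) (hq : IsMixed q) :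
    IsMixed fun a => (p a + q a) / 2 := by
  refine ⟨fun a => by linarith [hp.1 a, hq.1 a], ?_⟩
  rw [← sum_div, sum_add_distrib, hp.2, hq.2]
  norm_num

lemma strictConvexOn_mul_log_div {c : ℝ} (hc : 0 < c) :
    StrictConvexOn ℝ (Set.Ici 0) fun x => x * Real.log (x / c) := by
  have h : StrictConvexOn ℝ (Set.Ici 0) fun x : ℝ => x * Real.log x + -Real.log c * x :=
    Real.strictConvexOn_mul_log.add_convexOn
      ((LinearMap.mulLeft ℝ (-Real.log c)).convexOn (convex_Ici 0))
  refine h.congr fun x _ => ?_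
  rcases eq_or_ne x 0 with rfl | hx
  · simp
  · simp only [Real.log_div hx hc.ne']
    ring

lemma KL_midpoint_lt {α : Type*} [Fintype α] {p q m : α → ℝ} (hp : ∀ a, 0 ≤ p a)
    (hq : ∀ a, 0 ≤ q a) (hm : IsInterior m) (hne : p ≠ q) :
    KL (fun a => (p a + q a) / 2) m < (KL p m + KL q m) / 2 := by
  have strict (a : α) (h : p a ≠ q a) : (p a + q a) / 2 * Real.log ((p a + q a) / 2 / m a) <
      (p a * Real.log (p a / m a) + q a * Real.log (q a / m a)) / 2 := by
    have := (strictConvexOn_mul_log_div (hm a)).2 (hp a) (hq a) h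
      (one_half_pos (α := ℝ)) one_half_pos (add_halves 1)
    simp only [smul_eq_mul] at this
    rw [show (p a + q a) / 2 = 1 / 2 * p a + 1 / 2 * q a by ring]
    linarith
  obtain ⟨b, hb⟩ := Function.ne_iff.mp hne
  simp only [KL]
  rw [← sum_add_distrib, sum_div]
  refine sum_lt_sum (fun a _ => ?_) ⟨b, mem_univ b, strict b hb⟩
  by_cases h : p a = q a
  · rw [h, add_self_div_two, add_self_div_two]
  · exact (strict a h).le

/-- In a monotone game, the entropy-regularized transformed game
`Ṽ^i(π) = V^i(π) − η·KL(π^i, μ̄^i)` has at most one Nash equilibrium. -/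
theorem transformed_game_unique_nash
    {ι : Type*} [Fintype ι] [DecidableEq ι]
    {A : ι → Type*} [∀ i, Fintype (A i)] [∀ i, Nonempty (A i)]
    (r : ι → (∀ j, A j) → ℝ)
    (hmono : ∀ π μ : ∀ j, A j → ℝ, (∀ i, IsMixed (π i)) → (∀ i, IsMixed (μ i)) →
      ∑ i, Omega r i π μ ≤ 0)
    (η : ℝ) (hη : 0 < η)
    (m : ∀ i, A i → ℝ) (hm : ∀ i, IsMixed (m i)) (hmI : ∀ i, IsInterior (m i))
    (π π' : ∀ j, A j → ℝ) (hπ : ∀ i, IsMixed (π i)) (hπ' : ∀ i, IsMixed (π' i))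
    (hNπ : ∀ i (p : A i → ℝ), IsMixed p →
      Vfun (r i) (Function.update π i p) - η * KL p (m i) ≤
        Vfun (r i) π - η * KL (π i) (m i))
    (hNπ' : ∀ i (p : A i → ℝ), IsMixed p →
      Vfun (r i) (Function.update π' i p) - η * KL p (m i) ≤
        Vfun (r i) π' - η * KL (π' i) (m i)) :
    π = π' := by
  have hmid (i : ι) : 2 * η * (KL (fun a => (π i a + π' i a) / 2) (m i) -
      (KL (π i) (m i) + KL (π' i) (m i)) / 2) ≥ -(Omega r i π π' / 2) := by
    have h := hNπ i _ ((hπ i).midpoint (hπ' i))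
    have h' := hNπ' i _ ((hπ i).midpoint (hπ' i))
    rw [Vfun_update_midpoint, Function.update_eq_self] at h h'
    simp only [Omega]
    linarith
  by_contra hne
  obtain ⟨k, hk⟩ := Function.ne_iff.mp hne
  have hlt : ∑ i, -(Omega r i π π' / 2) < ∑ _i : ι, (0 : ℝ) := by
    refine sum_lt_sum (fun i _ => (hmid i).trans ?_) ⟨k, mem_univ k, (hmid k).trans_lt ?_⟩
    · refine mul_nonpos_of_nonneg_of_nonpos (by positivity) (sub_nonpos.2 ?_)
      by_cases h : π i = π' i
      · simp [h]
      · exact (KL_midpoint_lt (hπ i).1 (hπ' i).1 (hmI i) h).le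
    · exact mul_neg_of_pos_of_neg (by positivity)
        (sub_neg.2 (KL_midpoint_lt (hπ k).1 (hπ' k).1 (hmI k) hk))
  rw [sum_neg_distrib, ← sum_div, sum_const_zero] at hlt
  linarith [hmono π π' hπ hπ']
end

section
/- Let (A^1, …, A^N, r^1, …, r^N) be a monotone N-player finite normal-form game, η > 0, let π* be a Nash equilibrium of the original game, let μ be an interior strategy profile, and let π' be an interior Nash equilibrium of the transformed game with values Ṽ^i(π) = V^i(π) − η·KL(π^i, μ^i). Then Σ_{i=1}^N [KL(π*^i, π'^i) − KL(π*^i, μ^i)] ≤ −Σ_{i=1}^N KL(π'^i, μ^i). In particular, each step of the iterated-regularization procedure strictly decreases the sum of KL divergences to any Nash equilibrium unless π' = μ. -/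
open Finset

theorem Vfun_update {ι : Type*} [Fintype ι] [DecidableEq ι]
    {A : ι → Type*} [∀ i, Fintype (A i)]
    (r : (∀ j, A j) → ℝ) (π : ∀ j, A j → ℝ) (i : ι) (p : A i → ℝ) :
    Vfun r (Function.update π i p) =
      ∑ a : ∀ j, A j, p (a i) * ((∏ j ∈ univ.erase i, π j (a j)) * r a) := by
  unfold Vfun
  refine Finset.sum_congr rfl fun a _ => ?_
  rw [← Finset.mul_prod_erase univ _ (Finset.mem_univ i), Function.update_self, mul_assoc]
  congr 2
  refine Finset.prod_congr rfl fun j hj => ?_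
  rw [Function.update_of_ne (Finset.ne_of_mem_erase hj)]

/-- The expected payoff is affine in each player's own strategy. -/
theorem Vfun_update_segment {ι : Type*} [Fintype ι] [DecidableEq ι]
    {A : ι → Type*} [∀ i, Fintype (A i)]
    (r : (∀ j, A j) → ℝ) (π : ∀ j, A j → ℝ) (i : ι) (p : A i → ℝ) (t : ℝ) :
    Vfun r (Function.update π i fun a => π i a + t * (p a - π i a)) =
      Vfun r π + t * (Vfun r (Function.update π i p) - Vfun r π) := by
  have h := Vfun_update r π i (π i)
  rw [Function.update_eq_self] at h
  rw [Vfun_update, Vfun_update, h, ← Finset.sum_sub_distrib, Finset.mul_sum,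
    ← Finset.sum_add_distrib]
  exact Finset.sum_congr rfl fun a _ => by ring

theorem KL_sub_KL {α : Type*} [Fintype α] (q : α → ℝ) {ν μ : α → ℝ}
    (hν : IsInterior ν) (hμ : IsInterior μ) :
    KL q ν - KL q μ = -∑ a, q a * Real.log (ν a / μ a) := by
  unfold KL
  rw [← Finset.sum_sub_distrib, ← Finset.sum_neg_distrib]
  refine Finset.sum_congr rfl fun a _ => ?_
  rcases eq_or_ne (q a) 0 with h | h
  · simp [h]
  · rw [Real.log_div h (hν a).ne', Real.log_div h (hμ a).ne',
      Real.log_div (hν a).ne' (hμ a).ne']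
    ring

/-- The Kullback–Leibler divergence is bounded by the chi-squared divergence. -/
theorem KL_le_sum_sq_div {α : Type*} [Fintype α] {q ν : α → ℝ}
    (hq : IsMixed q) (hν : IsMixed ν) (hνI : IsInterior ν) :
    KL q ν ≤ ∑ a, (q a - ν a) ^ 2 / ν a := by
  have h : ∑ a, (q a - ν a) ^ 2 / ν a = ∑ a, q a * (q a / ν a - 1) := by
    have h0 : ∑ a, (q a - ν a) = 0 := by
      rw [Finset.sum_sub_distrib, hq.2, hν.2, sub_self]
    rw [← sub_eq_zero, ← Finset.sum_sub_distrib, ← neg_eq_zero, ← Finset.sum_neg_distrib, ← h0]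
    refine Finset.sum_congr rfl fun a _ => ?_
    have := (hνI a).ne'
    field_simp
    ring
  rw [h]
  refine Finset.sum_le_sum fun a _ => ?_
  rcases (hq.1 a).eq_or_lt with h0 | h0
  · simp [← h0]
  · exact mul_le_mul_of_nonneg_left
      (Real.log_le_sub_one_of_pos (div_pos h0 (hνI a))) h0.le

theorem IsMixed.segment {α : Type*} [Fintype α] {ν p : α → ℝ} (hν : IsMixed ν)
    (hp : IsMixed p) {t : ℝ} (ht0 : 0 ≤ t) (ht1 : t ≤ 1) :
    IsMixed fun a => ν a + t * (p a - ν a) := by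
  refine ⟨fun a => ?_, ?_⟩
  · nlinarith [mul_nonneg ht0 (hp.1 a), mul_nonneg (sub_nonneg.2 ht1) (hν.1 a)]
  · rw [Finset.sum_add_distrib, ← Finset.mul_sum, Finset.sum_sub_distrib, hν.2, hp.2]
    ring

theorem le_zero_of_forall_le_mul {δ K : ℝ} (hK : 0 ≤ K)
    (h : ∀ t, 0 < t → t ≤ 1 → δ ≤ K * t) : δ ≤ 0 := by
  by_contra! hδ
  have hpos : 0 < δ + K + 1 := by linarith
  have := h (δ / (δ + K + 1)) (div_pos hδ hpos) ((div_le_one hpos).2 (by linarith))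
  rw [← mul_div_assoc, le_div_iff₀ hpos] at this
  nlinarith

/-- First-order optimality condition for a maximizer of a KL-regularized payoff
in a player's own strategy. -/
theorem Vfun_sub_le_of_regularized_best_response {ι : Type*} [Fintype ι] [DecidableEq ι]
    {A : ι → Type*} [∀ i, Fintype (A i)]
    (r : (∀ j, A j) → ℝ) {η : ℝ} (hη : 0 < η) (π : ∀ j, A j → ℝ) (i : ι) {m p : A i → ℝ}
    (hm : IsInterior m) (hπ : IsMixed (π i)) (hπI : IsInterior (π i)) (hp : IsMixed p)
    (hbest : ∀ q : A i → ℝ, IsMixed q →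
      Vfun r (Function.update π i q) - η * KL q m ≤ Vfun r π - η * KL (π i) m) :
    Vfun r (Function.update π i p) - Vfun r π ≤
      η * ∑ a, (p a - π i a) * Real.log (π i a / m a) := by
  set L := ∑ a, (p a - π i a) * Real.log (π i a / m a) with hL
  set C := ∑ a, (p a - π i a) ^ 2 / π i a with hC
  have hC0 : 0 ≤ C := Finset.sum_nonneg fun a _ => div_nonneg (sq_nonneg _) (hπI a).le
  rw [← sub_nonpos]
  refine le_zero_of_forall_le_mul (mul_nonneg hη.le hC0) fun t ht0 ht1 => ?_
  have hq := hπ.segment hp ht0.le ht1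
  have hb := hbest _ hq
  rw [Vfun_update_segment] at hb
  have hd := KL_sub_KL (fun a => π i a + t * (p a - π i a)) hπI hm
  have hchi := KL_le_sum_sq_div hq hπ hπI
  have e1 : ∑ a, (π i a + t * (p a - π i a)) * Real.log (π i a / m a) = KL (π i) m + t * L := by
    rw [hL, KL, Finset.mul_sum, ← Finset.sum_add_distrib]
    exact Finset.sum_congr rfl fun a _ => by ring
  have e2 : ∑ a, (π i a + t * (p a - π i a) - π i a) ^ 2 / π i a = t ^ 2 * C := by
    rw [hC, Finset.mul_sum]
    exact Finset.sum_congr rfl fun a _ => by ring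
  rw [e1] at hd
  rw [e2] at hchi
  have hKL : KL (fun a => π i a + t * (p a - π i a)) m - KL (π i) m ≤ t * L + t ^ 2 * C := by
    linarith
  have := mul_le_mul_of_nonneg_left hKL hη.le
  refine le_of_mul_le_mul_left ?_ ht0
  linarith

/-- One step of the iterated-regularization procedure: if `π*` is a Nash equilibrium of
the original monotone game and `π'` is an interior Nash equilibrium of the game with
values `Ṽ^i(π) = V^i(π) − η·KL(π^i, μ^i)`, then
`Σ_i [KL(π*^i, π'^i) − KL(π*^i, μ^i)] ≤ −Σ_i KL(π'^i, μ^i)`. -/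
theorem iterated_regularization_step
    {ι : Type*} [Fintype ι] [DecidableEq ι]
    {A : ι → Type*} [∀ i, Fintype (A i)] [∀ i, Nonempty (A i)]
    (r : ι → (∀ j, A j) → ℝ)
    (hmono : ∀ π μ : ∀ j, A j → ℝ, (∀ i, IsMixed (π i)) → (∀ i, IsMixed (μ i)) →
      ∑ i, Omega r i π μ ≤ 0)
    (η : ℝ) (hη : 0 < η)
    (st : ∀ j, A j → ℝ) (hst : ∀ i, IsMixed (st i))
    (hstNash : ∀ i (p : A i → ℝ), IsMixed p →
      Vfun (r i) (Function.update st i p) ≤ Vfun (r i) st)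
    (μ : ∀ j, A j → ℝ) (hμ : ∀ i, IsMixed (μ i)) (hμI : ∀ i, IsInterior (μ i))
    (π' : ∀ j, A j → ℝ) (hπ' : ∀ i, IsMixed (π' i)) (hπ'I : ∀ i, IsInterior (π' i))
    (hNπ' : ∀ i (p : A i → ℝ), IsMixed p →
      Vfun (r i) (Function.update π' i p) - η * KL p (μ i) ≤
        Vfun (r i) π' - η * KL (π' i) (μ i)) :
    ∑ i, (KL (st i) (π' i) - KL (st i) (μ i)) ≤ - ∑ i, KL (π' i) (μ i) := by
  have hfoc : ∀ i, Vfun (r i) (Function.update π' i (st i)) - Vfun (r i) π' ≤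
      η * ∑ a, (st i a - π' i a) * Real.log (π' i a / μ i a) := fun i =>
    Vfun_sub_le_of_regularized_best_response (r i) hη π' i (hμI i) (hπ' i) (hπ'I i) (hst i)
      (hNπ' i)
  have hnonneg : 0 ≤ ∑ i, (Vfun (r i) (Function.update π' i (st i)) - Vfun (r i) π') := by
    have h1 : 0 ≤ ∑ i, (Vfun (r i) st - Vfun (r i) (Function.update st i (π' i))) :=
      Finset.sum_nonneg fun i _ => sub_nonneg.2 (hstNash i _ (hπ' i))
    have h2 : ∑ i, Omega r i st π' =
        ∑ i, (Vfun (r i) st - Vfun (r i) (Function.update st i (π' i))) -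
          ∑ i, (Vfun (r i) (Function.update π' i (st i)) - Vfun (r i) π') := by
      rw [← Finset.sum_sub_distrib]
      exact Finset.sum_congr rfl fun i _ => by rw [Omega]; ring
    have := hmono st π' hst hπ'
    linarith
  have hsum := hnonneg.trans (Finset.sum_le_sum fun i _ => hfoc i)
  rw [← Finset.mul_sum] at hsum
  have hlog := nonneg_of_mul_nonneg_right hsum hη
  rw [← sub_nonpos, sub_neg_eq_add, ← Finset.sum_add_distrib, ← neg_nonneg,
    ← Finset.sum_neg_distrib]
  refine hlog.trans_eq (Finset.sum_congr rfl fun i _ => ?_)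
  rw [KL_sub_KL (st i) (hπ'I i) (hμI i), KL, neg_add, neg_neg, ← sub_eq_add_neg,
    ← Finset.sum_sub_distrib]
  exact Finset.sum_congr rfl fun a _ => sub_mul _ _ _
end

section
/- Let (A^1, …, A^N, r^1, …, r^N) be a monotone N-player finite normal-form game whose set Π* of Nash equilibria is nonempty and consists only of interior profiles. Fix η > 0, let π_0 be the uniform strategy profile, and for k ≥ 1 let π_k be a Nash equilibrium of the transformed game with values Ṽ_k^i(π) = V^i(π) − η·KL(π^i, π_{k-1}^i) (such π_k is interior). Then the sequence (π_k) converges to the set of Nash equilibria of the original game: min_{π* ∈ Π*} Σ_{i=1}^N KL(π*^i, π_k^i) → 0 as k → ∞; in particular every limit point of (π_k) is a Nash equilibrium of the original game. -/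
open Finset Filter

/-- Nash equilibrium of the (original) game. -/
def IsNash {ι : Type*} [Fintype ι] [DecidableEq ι]
    {A : ι → Type*} [∀ i, Fintype (A i)]
    (r : ι → (∀ j, A j) → ℝ) (π : ∀ j, A j → ℝ) : Prop :=
  (∀ i, IsMixed (π i)) ∧
  ∀ i (p : A i → ℝ), IsMixed p → Vfun (r i) (Function.update π i p) ≤ Vfun (r i) π

/-- A mixed strategy has entries at most one. -/
lemma IsMixed.le_one {α : Type*} [Fintype α] {p : α → ℝ} (hp : IsMixed p) (a : α) :
    p a ≤ 1 :=
  hp.2 ▸ Finset.single_le_sum (fun b _ => hp.1 b) (Finset.mem_univ a)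

/-- The entropy integrand dominates a squared distance on the unit interval. -/
lemma sub_add_sq_div_four_le_mul_log_div {x y : ℝ} (hx : 0 ≤ x) (hx1 : x ≤ 1) (hy : 0 < y)
    (hy1 : y ≤ 1) : x - y + (x - y) ^ 2 / 4 ≤ x * Real.log (x / y) := by
  rcases hx.eq_or_lt with rfl | hx0
  · simp; nlinarith
  obtain ⟨s, hs, rfl⟩ : ∃ s : ℝ, 0 < s ∧ x = s ^ 2 :=
    ⟨√x, Real.sqrt_pos.2 hx0, (Real.sq_sqrt hx).symm⟩
  obtain ⟨t, ht, rfl⟩ : ∃ t : ℝ, 0 < t ∧ y = t ^ 2 :=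
    ⟨√y, Real.sqrt_pos.2 hy, (Real.sq_sqrt hy.le).symm⟩
  have hs1 : s ≤ 1 := by nlinarith
  have ht1 : t ≤ 1 := by nlinarith
  have hlog : 1 - t / s ≤ Real.log (s / t) := by
    have h := Real.one_sub_inv_le_log_of_pos (div_pos hs ht)
    rwa [inv_div] at h
  have hmul : 2 * s ^ 2 * (1 - t / s) ≤ 2 * s ^ 2 * Real.log (s / t) := by gcongr
  have heq : 2 * s ^ 2 * (1 - t / s) = 2 * s ^ 2 - 2 * s * t := by field_simp
  have hdiv : Real.log (s ^ 2 / t ^ 2) = 2 * Real.log (s / t) := by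
    rw [← div_pow, Real.log_pow]; norm_num
  have hst : (s + t) ^ 2 ≤ 4 := by nlinarith
  have hfac : (s ^ 2 - t ^ 2) ^ 2 = (s - t) ^ 2 * (s + t) ^ 2 := by ring
  have hle : (s - t) ^ 2 * (s + t) ^ 2 ≤ (s - t) ^ 2 * 4 := by gcongr
  rw [hdiv]
  nlinarith

section KL

variable {α : Type*} [Fintype α] {p q s : α → ℝ}

/-- A Pinsker-type inequality bounding the divergence below by the squared distance. -/
lemma sum_sq_div_four_le_KL (hp : IsMixed p) (hq : IsMixed q) (hqi : IsInterior q) :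
    ∑ a, (p a - q a) ^ 2 / 4 ≤ KL p q := by
  have h : ∑ a, (p a - q a + (p a - q a) ^ 2 / 4) ≤ KL p q :=
    Finset.sum_le_sum fun a _ =>
      sub_add_sq_div_four_le_mul_log_div (hp.1 a) (hp.le_one a) (hqi a) (hq.le_one a)
  rw [Finset.sum_add_distrib, Finset.sum_sub_distrib, hp.2, hq.2] at h
  linarith

lemma sq_div_four_le_KL (hp : IsMixed p) (hq : IsMixed q) (hqi : IsInterior q) (a : α) :
    (p a - q a) ^ 2 / 4 ≤ KL p q :=
  (Finset.single_le_sum (f := fun a => (p a - q a) ^ 2 / 4) (fun b _ => by positivity)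
    (Finset.mem_univ a)).trans (sum_sq_div_four_le_KL hp hq hqi)

lemma KL_nonneg (hp : IsMixed p) (hq : IsMixed q) (hqi : IsInterior q) : 0 ≤ KL p q :=
  (Finset.sum_nonneg fun a _ => by positivity).trans (sum_sq_div_four_le_KL hp hq hqi)

lemma eq_of_KL_nonpos (hp : IsMixed p) (hq : IsMixed q) (hqi : IsInterior q)
    (h : KL p q ≤ 0) : p = q := by
  funext a
  have := sq_div_four_le_KL hp hq hqi a
  nlinarith [sq_nonneg (p a - q a)]

/-- Changing the reference vector of the divergence. -/
lemma KL_eq_sub_sum_mul_log (p : α → ℝ) (hq : IsInterior q) (hs : IsInterior s) :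
    KL p s = KL p q - ∑ a, p a * Real.log (s a / q a) := by
  unfold KL
  rw [← Finset.sum_sub_distrib]
  refine Finset.sum_congr rfl fun a _ => ?_
  by_cases h : p a = 0
  · simp [h]
  · rw [Real.log_div h (hs a).ne', Real.log_div h (hq a).ne',
      Real.log_div (hs a).ne' (hq a).ne']
    ring

/-- A bound on the divergence from an interior vector bounds the second argument away from
the boundary. -/
lemma mul_exp_le_of_KL_le (hp : IsMixed p) (hpi : IsInterior p) (hq : IsMixed q)
    (hqi : IsInterior q) {C : ℝ} (hC : KL p q ≤ C) (a : α) :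
    p a * Real.exp (-((C + 1) / p a)) ≤ q a := by
  have hterm : p a * Real.log (p a / q a) - (p a - q a) ≤ KL p q := by
    have h := Finset.single_le_sum
      (f := fun a => p a * Real.log (p a / q a) - (p a - q a)) (s := Finset.univ)
      (fun b _ => by
        nlinarith [sub_add_sq_div_four_le_mul_log_div (hp.1 b) (hp.le_one b) (hqi b)
          (hq.le_one b), sq_nonneg (p b - q b)]) (Finset.mem_univ a)
    rw [Finset.sum_sub_distrib, Finset.sum_sub_distrib, hp.2, hq.2] at h
    simpa [KL] using h
  have hpa := hpi a
  have hlog : Real.log (p a / q a) ≤ (C + 1) / p a := by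
    rw [le_div_iff₀ hpa]
    nlinarith [hp.le_one a, hqi a]
  have hexp := (Real.log_le_iff_le_exp (div_pos hpa (hqi a))).1 hlog
  rw [div_le_iff₀ (hqi a)] at hexp
  rw [Real.exp_neg, ← div_eq_mul_inv, div_le_iff₀ (Real.exp_pos _)]
  linarith

/-- The maximizer of a linear functional regularized by the divergence is a softmax. -/
lemma exists_log_div_eq_of_isMax_regularized [Nonempty α] {g : α → ℝ} {η : ℝ} (hη : 0 < η)
    (hq : IsInterior q) (hp : IsMixed p)
    (hmax : ∀ s, IsMixed s →
      ∑ a, s a * g a - η * KL s q ≤ ∑ a, p a * g a - η * KL p q) :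
    IsInterior p ∧ ∃ L, ∀ a, Real.log (p a / q a) = g a / η - L := by
  set Z := ∑ a, q a * Real.exp (g a / η) with hZ
  have hZpos : 0 < Z :=
    Finset.sum_pos (fun a _ => mul_pos (hq a) (Real.exp_pos _)) Finset.univ_nonempty
  set s : α → ℝ := fun a => q a * Real.exp (g a / η) / Z with hs
  have hsi : IsInterior s := fun a => div_pos (mul_pos (hq a) (Real.exp_pos _)) hZpos
  have hsm : IsMixed s :=
    ⟨fun a => (hsi a).le, by rw [← Finset.sum_div, ← hZ, div_self hZpos.ne']⟩
  have hlog : ∀ a, Real.log (s a / q a) = g a / η - Real.log Z := fun a => by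
    have : s a / q a = Real.exp (g a / η) / Z := by
      have := (hq a).ne'
      simp only [hs]
      field_simp
    rw [this, Real.log_div (Real.exp_pos _).ne' hZpos.ne', Real.log_exp]
  have hsum : ∀ u : α → ℝ, IsMixed u →
      η * ∑ a, u a * Real.log (s a / q a) = ∑ a, u a * g a - η * Real.log Z := fun u hu => by
    calc η * ∑ a, u a * Real.log (s a / q a)
        = ∑ a, (u a * g a - u a * (η * Real.log Z)) := by
          rw [Finset.mul_sum]
          refine Finset.sum_congr rfl fun a _ => ?_
          rw [hlog]
          field_simp
      _ = _ := by rw [Finset.sum_sub_distrib, ← Finset.sum_mul, hu.2, one_mul]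
  have hle := hmax s hsm
  have hps := hsum p hp
  have hss : η * KL s q = ∑ a, s a * g a - η * Real.log Z := hsum s hsm
  have hKL := KL_eq_sub_sum_mul_log p hq hsi
  have hnonpos : KL p s ≤ 0 := by
    have : η * KL p s ≤ 0 := by rw [hKL, mul_sub]; linarith
    nlinarith
  rw [eq_of_KL_nonpos hp hsm hsi hnonpos]
  exact ⟨hsi, _, hlog⟩

end KL

section Game

variable {ι : Type*} [Fintype ι] [DecidableEq ι] {A : ι → Type*} [∀ i, Fintype (A i)]

/-- The expected payoff is linear in each player's strategy. -/
lemma exists_Vfun_update_eq_sum (r : (∀ j, A j) → ℝ) (π : ∀ j, A j → ℝ) (i : ι) :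
    ∃ g : A i → ℝ, ∀ p, Vfun r (Function.update π i p) = ∑ b, p b * g b := by
  classical
  refine ⟨fun b => ∑ a : ∀ j, A j,
    if a i = b then (∏ j ∈ Finset.univ.erase i, π j (a j)) * r a else 0, fun p => ?_⟩
  simp_rw [Finset.mul_sum]
  rw [Finset.sum_comm]
  refine Finset.sum_congr rfl fun a _ => ?_
  rw [← Finset.mul_prod_erase Finset.univ _ (Finset.mem_univ i)]
  have hprod : ∏ j ∈ Finset.univ.erase i, Function.update π i p j (a j) =
      ∏ j ∈ Finset.univ.erase i, π j (a j) :=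
    Finset.prod_congr rfl fun j hj => by
      rw [Function.update_of_ne (Finset.ne_of_mem_erase hj)]
  rw [hprod]
  simp [mul_assoc]

lemma continuous_Vfun (r : (∀ j, A j) → ℝ) : Continuous (Vfun r) := by
  unfold Vfun
  fun_prop

/-- A regularized equilibrium relative to an interior profile is interior and satisfies the
three-point identity. -/
lemma regularized_three_point [∀ i, Nonempty (A i)] {r : (∀ j, A j) → ℝ} {η : ℝ}
    (hη : 0 < η) {π μ : ∀ j, A j → ℝ} {i : ι} (hμ : IsInterior (μ i)) (hπ : IsMixed (π i))
    (hmax : ∀ p, IsMixed p →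
      Vfun r (Function.update π i p) - η * KL p (μ i) ≤ Vfun r π - η * KL (π i) (μ i)) :
    IsInterior (π i) ∧ ∀ p, IsMixed p →
      η * (KL p (π i) - KL p (μ i) + KL (π i) (μ i)) =
        Vfun r π - Vfun r (Function.update π i p) := by
  obtain ⟨g, hg⟩ := exists_Vfun_update_eq_sum r π i
  have hgπ : Vfun r π = ∑ b, π i b * g b := by
    rw [← hg, Function.update_eq_self]
  simp only [hg, hgπ] at hmax ⊢
  obtain ⟨hint, L, hL⟩ := exists_log_div_eq_of_isMax_regularized hη hμ hπ hmax
  refine ⟨hint, fun p hp => ?_⟩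
  have hsum : ∀ u : A i → ℝ, IsMixed u →
      η * ∑ a, u a * Real.log (π i a / μ i a) = ∑ a, u a * g a - η * L := fun u hu => by
    calc η * ∑ a, u a * Real.log (π i a / μ i a)
        = ∑ a, (u a * g a - u a * (η * L)) := by
          rw [Finset.mul_sum]
          refine Finset.sum_congr rfl fun a _ => ?_
          rw [hL]
          field_simp
      _ = _ := by rw [Finset.sum_sub_distrib, ← Finset.sum_mul, hu.2, one_mul]
  have hπ' : η * KL (π i) (μ i) = ∑ a, π i a * g a - η * L := hsum _ hπ
  have hp' := hsum p hp
  rw [KL_eq_sub_sum_mul_log p hμ hint]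
  linarith

/-- Against a Nash equilibrium of a monotone game, the total gain from deviating to the
equilibrium strategies is nonnegative. -/
lemma sum_Vfun_sub_update_nonpos {r : ι → (∀ j, A j) → ℝ}
    (hmono : ∀ π μ : ∀ j, A j → ℝ, (∀ i, IsMixed (π i)) → (∀ i, IsMixed (μ i)) →
      ∑ i, Omega r i π μ ≤ 0)
    {π ν : ∀ j, A j → ℝ} (hπ : ∀ i, IsMixed (π i)) (hν : IsNash r ν) :
    ∑ i, (Vfun (r i) π - Vfun (r i) (Function.update π i (ν i))) ≤ 0 := by
  refine le_trans (Finset.sum_le_sum fun i _ => ?_) (hmono π ν hπ hν.1)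
  unfold Omega
  linarith [hν.2 i (π i) (hπ i)]

/-- A cluster point of mixed profiles whose deviation gains vanish is a Nash equilibrium. -/
lemma isNash_of_mapClusterPt {r : ι → (∀ j, A j) → ℝ} {π : ℕ → ∀ j, A j → ℝ}
    (hmix : ∀ k i, IsMixed (π k i))
    (hgain : ∀ i (p : A i → ℝ), IsMixed p → ∀ ε > 0, ∀ᶠ k in atTop,
      Vfun (r i) (Function.update (π k) i p) - Vfun (r i) (π k) < ε)
    {q : ∀ j, A j → ℝ} (hq : MapClusterPt q atTop π) : IsNash r q := by
  have hclosed : ∀ S : Set (∀ j, A j → ℝ), IsClosed S → (∀ᶠ k in atTop, π k ∈ S) → q ∈ S :=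
    fun S hS h => hS.mem_of_mapClusterPt hq h
  refine ⟨fun i => ⟨fun a => ?_, ?_⟩, fun i p hp => ?_⟩
  · exact hclosed {x | 0 ≤ x i a} (isClosed_le (by fun_prop) (by fun_prop))
      (Eventually.of_forall fun k => (hmix k i).1 a)
  · exact hclosed {x | ∑ a, x i a = 1} (isClosed_eq (by fun_prop) (by fun_prop))
      (Eventually.of_forall fun k => (hmix k i).2)
  · refine le_of_forall_pos_le_add fun ε hε => ?_
    have hcont : Continuous fun x : ∀ j, A j → ℝ => Vfun (r i) (Function.update x i p) :=
      (continuous_Vfun (r i)).comp (continuous_id.update i continuous_const)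
    refine hclosed {x | Vfun (r i) (Function.update x i p) ≤ Vfun (r i) x + ε}
      (isClosed_le hcont ((continuous_Vfun (r i)).add continuous_const)) ?_
    filter_upwards [hgain i p hp ε hε] with k hk
    linarith

end Game

/-- Convergence of the iterated-regularization procedure: in a monotone game whose Nash
equilibria are all interior (and exist), the sequence `π_k`, where `π_{k+1}` is a Nash
equilibrium of the game regularized towards `π_k` starting from the uniform profile
`π_0`, converges to the set of Nash equilibria of the original game; in particular every
limit point of `(π_k)` is a Nash equilibrium. -/
theorem iterated_regularization_converges_to_nash
    {ι : Type*} [Fintype ι] [DecidableEq ι]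
    {A : ι → Type*} [∀ i, Fintype (A i)] [∀ i, Nonempty (A i)]
    (r : ι → (∀ j, A j) → ℝ)
    (hmono : ∀ π μ : ∀ j, A j → ℝ, (∀ i, IsMixed (π i)) → (∀ i, IsMixed (μ i)) →
      ∑ i, Omega r i π μ ≤ 0)
    (hne : ∃ π, IsNash r π)
    (hint : ∀ π, IsNash r π → ∀ i, IsInterior (π i))
    (η : ℝ) (hη : 0 < η)
    (π : ℕ → ∀ j, A j → ℝ)
    (h0 : ∀ i (a : A i), π 0 i a = 1 / (Fintype.card (A i) : ℝ))
    (hmix : ∀ k i, IsMixed (π k i))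
    (hstep : ∀ k, ∀ i (p : A i → ℝ), IsMixed p →
      Vfun (r i) (Function.update (π (k + 1)) i p) - η * KL p (π k i) ≤
        Vfun (r i) (π (k + 1)) - η * KL (π (k + 1) i) (π k i)) :
    Tendsto (fun k => ⨅ q : {q : ∀ j, A j → ℝ // IsNash r q}, ∑ i, KL (q.1 i) (π k i))
      atTop (nhds 0) ∧
    ∀ q : ∀ j, A j → ℝ, MapClusterPt q atTop π → IsNash r q := by
  have hinter : ∀ k i, IsInterior (π k i) := by
    intro k
    induction k with
    | zero => intro i a; rw [h0]; have := Fintype.card_pos (α := A i); positivity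
    | succ k ih => exact fun i => (regularized_three_point hη (ih i) (hmix _ i) (hstep k i)).1
  have hthree := fun k i =>
    (regularized_three_point hη (hinter k i) (hmix _ i) (hstep k i)).2
  have hnn : ∀ (ν : ∀ j, A j → ℝ), (∀ i, IsMixed (ν i)) → ∀ k i, 0 ≤ KL (ν i) (π k i) :=
    fun ν hν k i => KL_nonneg (hν i) (hmix k i) (hinter k i)
  have hdesc : ∀ ν, IsNash r ν → ∀ k,
      ∑ i, KL (ν i) (π (k + 1) i) + ∑ i, KL (π (k + 1) i) (π k i) ≤
        ∑ i, KL (ν i) (π k i) := by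
    intro ν hν k
    have h := sum_Vfun_sub_update_nonpos hmono (hmix (k + 1)) hν
    rw [← Finset.sum_congr rfl fun i _ => hthree k i (ν i) (hν.1 i), ← Finset.mul_sum,
      Finset.sum_add_distrib, Finset.sum_sub_distrib] at h
    nlinarith
  have hanti : ∀ ν, IsNash r ν → Antitone fun k => ∑ i, KL (ν i) (π k i) := fun ν hν =>
    antitone_nat_of_succ_le fun k => by
      have := hdesc ν hν k
      have := Finset.sum_nonneg fun i (_ : i ∈ Finset.univ) => hnn _ (hmix (k + 1)) k i
      linarith
  have hnash : ∀ q, MapClusterPt q atTop π → IsNash r q := by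
    obtain ⟨ν, hν⟩ := hne
    have hbdd : BddBelow (Set.range fun k => ∑ i, KL (ν i) (π k i)) :=
      ⟨0, by rintro _ ⟨k, rfl⟩; exact Finset.sum_nonneg fun i _ => hnn ν hν.1 k i⟩
    have hlim := tendsto_atTop_ciInf (hanti ν hν) hbdd
    have hdiff := hlim.sub (hlim.comp (tendsto_add_atTop_nat 1))
    rw [sub_self] at hdiff
    have hstep0 : ∀ i a, Tendsto (fun k => |π (k + 1) i a - π k i a|) atTop (nhds 0) := by
      intro i a
      have hsq : Tendsto (fun k => (π (k + 1) i a - π k i a) ^ 2) atTop (nhds 0) := by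
        refine squeeze_zero (fun k => sq_nonneg _) (fun k => ?_)
          (by simpa using hdiff.const_mul 4)
        have h1 := sq_div_four_le_KL (hmix (k + 1) i) (hmix k i) (hinter k i) a
        have h2 := Finset.single_le_sum
          (fun i (_ : i ∈ Finset.univ) => hnn _ (hmix (k + 1)) k i) (Finset.mem_univ i)
        have h3 := hdesc ν hν k
        linarith
      simpa [Real.sqrt_sq_eq_abs] using hsq.sqrt
    have hlow : ∀ i a, ∃ c > 0, ∀ k, c ≤ π k i a := fun i a =>
      ⟨_, mul_pos (hint ν hν i a) (Real.exp_pos _), fun k =>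
        mul_exp_le_of_KL_le (hν.1 i) (hint ν hν i) (hmix k i) (hinter k i)
          ((Finset.single_le_sum (fun i (_ : i ∈ Finset.univ) => hnn ν hν.1 k i)
            (Finset.mem_univ i)).trans (hanti ν hν (Nat.zero_le k))) a⟩
    choose c hc hcle using hlow
    refine fun q hq => isNash_of_mapClusterPt hmix (fun i p hp ε hε => ?_) hq
    have hsmall : Tendsto (fun k => η * ∑ a, p a * (|π (k + 1) i a - π k i a| / c i a))
        atTop (nhds 0) := by
      have := (tendsto_finsetSum Finset.univ fun a _ =>
        ((hstep0 i a).div_const (c i a)).const_mul (p a)).const_mul η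
      simpa using this
    obtain ⟨K, hK⟩ := eventually_atTop.1 (hsmall.eventually_lt_const hε)
    filter_upwards [eventually_ge_atTop (K + 1)] with k hk
    obtain ⟨m, rfl⟩ : ∃ m, k = m + 1 := ⟨k - 1, by omega⟩
    refine lt_of_le_of_lt ?_ (hK m (by omega))
    have hlog : ∑ a, p a * Real.log (π (m + 1) i a / π m i a) ≤
        ∑ a, p a * (|π (m + 1) i a - π m i a| / c i a) := by
      refine Finset.sum_le_sum fun a _ => mul_le_mul_of_nonneg_left ?_ (hp.1 a)
      have hpos := hinter m i a
      calc Real.log (π (m + 1) i a / π m i a)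
          ≤ π (m + 1) i a / π m i a - 1 :=
            Real.log_le_sub_one_of_pos (div_pos (hinter _ i a) hpos)
        _ = (π (m + 1) i a - π m i a) / π m i a := by field_simp
        _ ≤ |π (m + 1) i a - π m i a| / π m i a := by gcongr; exact le_abs_self _
        _ ≤ _ := div_le_div_of_nonneg_left (abs_nonneg _) (hc i a) (hcle i a m)
    have h1 := hthree m i p hp
    rw [KL_eq_sub_sum_mul_log p (hinter m i) (hinter (m + 1) i)] at h1
    have h2 := mul_nonneg hη.le (hnn _ (hmix (m + 1)) m i)
    have h3 := mul_le_mul_of_nonneg_left hlog hη.le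
    linarith
  refine ⟨?_, hnash⟩
  obtain ⟨q, hq⟩ : ∃ q, MapClusterPt q atTop π := by
    have hcomp : IsCompact (Set.univ.pi fun j : ι =>
        Set.univ.pi fun _ : A j => Set.Icc (0 : ℝ) 1) :=
      isCompact_univ_pi fun j => isCompact_univ_pi fun _ => isCompact_Icc
    obtain ⟨q, -, hq⟩ := hcomp.exists_mapClusterPt (f := atTop) (u := π)
      (tendsto_principal.2 (Eventually.of_forall fun k j _ a _ =>
        ⟨(hmix k j).1 a, (hmix k j).le_one a⟩))
    exact ⟨q, hq⟩
  have hqN := hnash q hq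
  have hcont : ContinuousAt (fun x : ∀ j, A j → ℝ => ∑ i, KL (q i) (x i)) q := by
    unfold KL
    refine tendsto_finsetSum _ fun i _ => tendsto_finsetSum _ fun a _ => ?_
    have hpos := hint q hqN i a
    have happ : ContinuousAt (fun x : ∀ j, A j → ℝ => x i a) q :=
      ((continuous_apply a).comp (continuous_apply i)).continuousAt
    exact ((continuousAt_const.div happ hpos.ne').log
      (div_pos hpos hpos).ne').const_mul (q i a)
  have hself : ∑ i, KL (q i) (q i) = 0 :=
    Finset.sum_eq_zero fun i _ => Finset.sum_eq_zero fun a _ => by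
      rw [div_self (hint q hqN i a).ne', Real.log_one, mul_zero]
  have hconv : Tendsto (fun k => ∑ i, KL (q i) (π k i)) atTop (nhds 0) := by
    have hfreq : ∀ ε > 0, ∃ k, ∑ i, KL (q i) (π k i) < ε := fun ε hε =>
      (hq.frequently (hcont.eventually_lt_const (hself.trans_lt hε))).exists
    rw [tendsto_order]
    refine ⟨fun b hb => Eventually.of_forall fun k =>
      hb.trans_le (Finset.sum_nonneg fun i _ => hnn q hqN.1 k i), fun b hb => ?_⟩
    obtain ⟨K, hK⟩ := hfreq b hb
    filter_upwards [eventually_ge_atTop K] with k hk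
    exact (hanti q hqN hk).trans_lt hK
  refine squeeze_zero
    (fun k => Real.iInf_nonneg fun ν => Finset.sum_nonneg fun i _ => hnn ν.1 ν.2.1 k i)
    (fun k => ?_) hconv
  exact ciInf_le (f := fun ν : {ν : ∀ j, A j → ℝ // IsNash r ν} =>
    ∑ i, KL (ν.1 i) (π k i))
    ⟨0, by rintro _ ⟨ν, rfl⟩; exact Finset.sum_nonneg fun i _ => hnn ν.1 ν.2.1 k i⟩ ⟨q, hqN⟩
end
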